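/- Let σ₀,…,σₙ,σ_{n+1}, τ₀,…,τ_m, τ'₀,…,τ'_m be finite binary strings and suppose there exist finite binary strings η, ν, θ₀,…,θ_m such that τᵢ = η⌢θᵢ and τ'ᵢ = ν⌢θᵢ for each i ≤ m. Assume: (i) there exists l ∈ {0,1} such that σ_{n+1}⌢⟨l⟩ ⊴ η and σ_{n+1}⌢⟨l⟩ ⊴ ν; (ii) for that l, no i ≤ n satisfies σ_{n+1}⌢⟨l⟩ ⊴ σᵢ; (iii) σ_{n+1}⌢⟨1⟩ ≠ η and σ_{n+1}⌢⟨1⟩ ≠ ν. Then cl(⟨σ₀,…,σₙ,σ_{n+1},τ₀,…,τ_m⟩) ≈_β cl(⟨σ₀,…,σₙ,σ_{n+1},τ'₀,…,τ'_m⟩). (Remark 4.7.) -/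

import Mathlib

/-- The meet `η ∧ ν` of two finite binary strings: their longest common prefix. -/
def lcp : List Bool → List Bool → List Bool
  | a :: as, b :: bs => if a = b then a :: lcp as bs else []
  | _, _ => []

/-- `η ⊥ ν`: the strings are incomparable (neither is a prefix of the other). -/
def Incomp (a b : List Bool) : Prop := ¬ a <+: b ∧ ¬ b <+: a

/-- A tuple of strings is ∧-closed if the meet of any two entries is again an entry. -/
def MeetClosed {ι : Type*} (t : ι → List Bool) : Prop :=
  ∀ i j : ι, ∃ k : ι, lcp (t i) (t j) = t k

/-- `s ≈_α t`: both tuples are ∧-closed, and they satisfy the same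
`⊴`-relations and the same `⌢⟨d⟩⊴`-relations between entries. -/
def EqvA {ι : Type*} (s t : ι → List Bool) : Prop :=
  MeetClosed s ∧ MeetClosed t ∧
  (∀ i j : ι, s i <+: s j ↔ t i <+: t j) ∧
  (∀ (i j : ι) (d : Bool), s i ++ [d] <+: s j ↔ t i ++ [d] <+: t j)

/-- `s ≈_β t`: `≈_α` together with preservation of the relation `ηᵢ⌢⟨1⟩ = ηⱼ`. -/
def EqvB {ι : Type*} (s t : ι → List Bool) : Prop :=
  EqvA s t ∧ ∀ i j : ι, s i ++ [true] = s j ↔ t i ++ [true] = t j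

/-- `s ≈_γ t`: `≈_β` together with preservation of `ηᵢ⌢⟨0⟩ = ηⱼ` and of
ending with `0` resp. with `1`. -/
def EqvG {ι : Type*} (s t : ι → List Bool) : Prop :=
  EqvB s t ∧
  (∀ i j : ι, s i ++ [false] = s j ↔ t i ++ [false] = t j) ∧
  (∀ i : ι, (s i).getLast? = some false ↔ (t i).getLast? = some false) ∧
  (∀ i : ι, (s i).getLast? = some true ↔ (t i).getLast? = some true)

/-- The meet-closure tuple of a tuple of strings: all pairwise meets. -/
def cl {ι : Type*} (t : ι → List Bool) : ι × ι → List Bool :=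
  fun p => lcp (t p.1) (t p.2)

theorem prefix_lcp_iff {x a b : List Bool} : x <+: lcp a b ↔ x <+: a ∧ x <+: b := by
  induction a generalizing x b with
  | nil => cases x <;> simp [lcp]
  | cons c a ih =>
    cases b with
    | nil => cases x <;> simp [lcp]
    | cons d b =>
      cases x with
      | nil => simp
      | cons e x =>
        by_cases h : c = d
        · subst h
          simp [lcp, List.cons_prefix_cons, ih]
          tauto
        · simp only [lcp, h, if_false, List.cons_prefix_cons, List.prefix_nil]
          grind

theorem List.IsPrefix.antisymm' {a b : List Bool} (h₁ : a <+: b) (h₂ : b <+: a) : a = b :=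
  h₁.eq_of_length_le h₂.length_le

theorem eq_of_prefix_iff {a b : List Bool} (h : ∀ x, x <+: a ↔ x <+: b) : a = b :=
  ((h a).1 (List.prefix_refl a)).antisymm' ((h b).2 (List.prefix_refl b))

theorem lcp_comm (a b : List Bool) : lcp a b = lcp b a :=
  eq_of_prefix_iff fun x => by simp only [prefix_lcp_iff]; exact and_comm

theorem lcp_prefix_left (a b : List Bool) : lcp a b <+: a :=
  (prefix_lcp_iff.1 (List.prefix_refl _)).1

theorem lcp_prefix_right (a b : List Bool) : lcp a b <+: b :=
  (prefix_lcp_iff.1 (List.prefix_refl _)).2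

theorem lcp_append_append (c a b : List Bool) : lcp (c ++ a) (c ++ b) = c ++ lcp a b := by
  induction c with
  | nil => rfl
  | cons d c ih => simp [lcp, ih]

/-- Among two strings having a common extension, one is the meet. -/
theorem lcp_eq_or_of_prefix {x y a : List Bool} (hx : x <+: a) (hy : y <+: a) :
    lcp x y = x ∨ lcp x y = y := by
  rcases List.prefix_or_prefix_of_prefix hx hy with h | h
  · exact .inl ((lcp_prefix_left x y).antisymm' (prefix_lcp_iff.2 ⟨List.prefix_refl _, h⟩))
  · exact .inr ((lcp_prefix_right x y).antisymm' (prefix_lcp_iff.2 ⟨h, List.prefix_refl _⟩))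

theorem lcp_lcp_eq_or (a b c : List Bool) :
    lcp (lcp a b) c = lcp a b ∨ lcp (lcp a b) c = lcp a c := by
  have h : lcp (lcp a b) c = lcp (lcp a b) (lcp a c) :=
    eq_of_prefix_iff fun x => by simp only [prefix_lcp_iff]; tauto
  rw [h]
  exact lcp_eq_or_of_prefix (lcp_prefix_left a b) (lcp_prefix_left a c)

theorem meetClosed_cl {ι : Type*} (t : ι → List Bool) : MeetClosed (cl t) := by
  rintro ⟨i, j⟩ ⟨k, l⟩
  have h : lcp (lcp (t i) (t j)) (lcp (t k) (t l)) =
      lcp (lcp (lcp (t i) (t j)) (t k)) (t l) :=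
    eq_of_prefix_iff fun x => by simp only [prefix_lcp_iff]; tauto
  simp only [cl, Prod.exists, h]
  rcases lcp_lcp_eq_or (t i) (t j) (t k) with h₁ | h₁ <;> rw [h₁]
  · rcases lcp_lcp_eq_or (t i) (t j) (t l) with h₂ | h₂ <;> exact ⟨_, _, h₂⟩
  · rcases lcp_lcp_eq_or (t i) (t k) (t l) with h₂ | h₂ <;> exact ⟨_, _, h₂⟩

/-- If `p ⊴ a` and `p` is not a prefix of `w`, then `w ∧ a = w ∧ p`. -/
theorem lcp_eq_of_prefix_of_not_prefix {p a w : List Bool} (hp : p <+: a) (hw : ¬ p <+: w) :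
    lcp w a = lcp w p :=
  eq_of_prefix_iff fun x => by
    simp only [prefix_lcp_iff]
    refine and_congr_right fun hx => ⟨fun hxa => ?_, fun hxp => hxp.trans hp⟩
    exact (List.prefix_or_prefix_of_prefix hxa hp).resolve_right fun h => hw (h.trans hx)

theorem prefix_iff_of_not_prefix {p a w : List Bool} (hp : p <+: a) (hw : ¬ p <+: w) :
    w <+: a ↔ w <+: p :=
  ⟨fun h => (List.prefix_or_prefix_of_prefix h hp).resolve_right hw, fun h => h.trans hp⟩

theorem append_singleton_prefix_iff_of_not_prefix {p a w : List Bool} {d : Bool}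
    (hp : p <+: a) (hw : ¬ p <+: w) : w ++ [d] <+: a ↔ w ++ [d] <+: p := by
  refine ⟨fun h => ?_, fun h => h.trans hp⟩
  rcases List.prefix_or_prefix_of_prefix h hp with h' | h'
  · exact h'
  · rcases List.prefix_concat_iff.1 h' with rfl | h'
    · exact List.prefix_refl _
    · exact absurd h' hw

theorem append_true_ne_append {q η w u : List Bool} {l : Bool} (hη : q ++ [l] <+: η)
    (hne : q ++ [true] ≠ η) (hw : ¬ q ++ [l] <+: w) : w ++ [true] ≠ η ++ u := by
  intro h
  have h₁ : η <+: w ++ [true] := h ▸ List.prefix_append η u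
  rcases List.prefix_concat_iff.1 h₁ with rfl | h₂
  · rcases List.prefix_concat_iff.1 hη with h₃ | h₃
    · obtain ⟨rfl, -⟩ := List.append_inj' h₃ rfl
      exact hne rfl
    · exact hw h₃
  · exact hw (hη.trans h₂)

/-- `x` and `y` are either the same string not extending `p`, or are obtained by appending the
same string to `η` and to `ν` respectively. -/
def MovedAbove (p η ν x y : List Bool) : Prop :=
  (x = y ∧ ¬ p <+: x) ∨ ∃ u, x = η ++ u ∧ y = ν ++ u

theorem movedAbove_lcp {p η ν x₁ y₁ x₂ y₂ : List Bool} (hη : p <+: η) (hν : p <+: ν)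
    (h₁ : MovedAbove p η ν x₁ y₁) (h₂ : MovedAbove p η ν x₂ y₂) :
    MovedAbove p η ν (lcp x₁ x₂) (lcp y₁ y₂) := by
  rcases h₁ with ⟨rfl, h₁⟩ | ⟨u, rfl, rfl⟩
  · refine .inl ⟨?_, fun h => h₁ (h.trans (lcp_prefix_left _ _))⟩
    rcases h₂ with ⟨rfl, -⟩ | ⟨v, rfl, rfl⟩
    · rfl
    · rw [lcp_eq_of_prefix_of_not_prefix (hη.trans (List.prefix_append _ _)) h₁,
        lcp_eq_of_prefix_of_not_prefix (hν.trans (List.prefix_append _ _)) h₁]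
  · rcases h₂ with ⟨rfl, h₂⟩ | ⟨v, rfl, rfl⟩
    · refine .inl ⟨?_, fun h => h₂ (h.trans (lcp_prefix_right _ _))⟩
      rw [lcp_comm _ x₂, lcp_comm _ x₂,
        lcp_eq_of_prefix_of_not_prefix (hη.trans (List.prefix_append _ _)) h₂,
        lcp_eq_of_prefix_of_not_prefix (hν.trans (List.prefix_append _ _)) h₂]
    · exact .inr ⟨_, lcp_append_append _ _ _, lcp_append_append _ _ _⟩

theorem eqvB_of_movedAbove {ι : Type*} {s t : ι → List Bool} {q η ν : List Bool} {l : Bool}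
    (hs : MeetClosed s) (ht : MeetClosed t)
    (hη : q ++ [l] <+: η) (hν : q ++ [l] <+: ν)
    (hη' : q ++ [true] ≠ η) (hν' : q ++ [true] ≠ ν)
    (h : ∀ i, MovedAbove (q ++ [l]) η ν (s i) (t i)) : EqvB s t := by
  have hηu (u) : q ++ [l] <+: η ++ u := hη.trans (List.prefix_append _ _)
  have hνu (u) : q ++ [l] <+: ν ++ u := hν.trans (List.prefix_append _ _)
  refine ⟨⟨hs, ht, fun i j => ?_, fun i j d => ?_⟩, fun i j => ?_⟩ <;>
    rcases h i with ⟨hi, hi'⟩ | ⟨u, hi, hi'⟩ <;> rcases h j with ⟨hj, hj'⟩ | ⟨v, hj, hj'⟩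
  · rw [← hi, ← hj]
  · rw [← hi, hj, hj', prefix_iff_of_not_prefix (hηu v) hi',
      prefix_iff_of_not_prefix (hνu v) hi']
  · rw [← hj, hi, hi']
    exact iff_of_false (fun h => hj' ((hηu u).trans h)) (fun h => hj' ((hνu u).trans h))
  · rw [hi, hi', hj, hj', List.prefix_append_right_inj, List.prefix_append_right_inj]
  · rw [← hi, ← hj]
  · rw [← hi, hj, hj', append_singleton_prefix_iff_of_not_prefix (hηu v) hi',
      append_singleton_prefix_iff_of_not_prefix (hνu v) hi']
  · rw [← hj, hi, hi', List.append_assoc, List.append_assoc]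
    exact iff_of_false (fun h => hj' ((hηu _).trans h)) (fun h => hj' ((hνu _).trans h))
  · rw [hi, hi', hj, hj', List.append_assoc, List.append_assoc,
      List.prefix_append_right_inj, List.prefix_append_right_inj]
  · rw [← hi, ← hj]
  · rw [← hi, hj, hj']
    exact iff_of_false (append_true_ne_append hη hη' hi') (append_true_ne_append hν hν' hi')
  · rw [← hj, hi, hi', List.append_assoc, List.append_assoc]
    exact iff_of_false (fun h => hj' (h ▸ hηu _)) (fun h => hj' (h ▸ hνu _))
  · rw [hi, hi', hj, hj', List.append_assoc, List.append_assoc,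
      List.append_right_inj, List.append_right_inj]

/-- Remark 4.7: under the stated hypotheses on `σ₀,…,σ_{n+1}`, `τ₀,…,τ_m`
(`τᵢ = η⌢θᵢ`) and `τ'₀,…,τ'_m` (`τ'ᵢ = ν⌢θᵢ`), the meet-closures of the
concatenated tuples are `≈_β`-equivalent. -/
theorem stmt12 (n m : ℕ) (σ : Fin (n + 2) → List Bool)
    (τ τ' : Fin (m + 1) → List Bool)
    (η ν : List Bool) (θ : Fin (m + 1) → List Bool)
    (hτ : ∀ i, τ i = η ++ θ i) (hτ' : ∀ i, τ' i = ν ++ θ i)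
    (l : Bool)
    (h1η : σ (Fin.last (n + 1)) ++ [l] <+: η)
    (h1ν : σ (Fin.last (n + 1)) ++ [l] <+: ν)
    (h2 : ∀ i : Fin (n + 1), ¬ σ (Fin.last (n + 1)) ++ [l] <+: σ i.castSucc)
    (h3η : σ (Fin.last (n + 1)) ++ [true] ≠ η)
    (h3ν : σ (Fin.last (n + 1)) ++ [true] ≠ ν) :
    EqvB (cl (Sum.elim σ τ)) (cl (Sum.elim σ τ')) := by
  have key (i) : MovedAbove (σ (Fin.last (n + 1)) ++ [l]) η ν
      (Sum.elim σ τ i) (Sum.elim σ τ' i) := by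
    rcases i with i | i
    · refine .inl ⟨rfl, ?_⟩
      induction i using Fin.lastCases with
      | last => exact fun h => by simpa using h.length_le
      | cast i => exact h2 i
    · exact .inr ⟨θ i, hτ i, hτ' i⟩
  exact eqvB_of_movedAbove (meetClosed_cl _) (meetClosed_cl _) h1η h1ν h3η h3ν
    fun k => movedAbove_lcp h1η h1ν (key k.1) (key k.2)
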